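/- Let n be a positive integer, let N and M be nonnegative integers with M ≤ N, and suppose A(1,n;N,M) ∈ ℤ[q]. Then for any nonnegative integer m, n divides the integer ∑_{j ≥ 0} C(N + mn, M + jn), where C(x,y) denotes the binomial coefficient and the sum is over all nonnegative integers j with M + jn ≤ N + mn. -/

import Mathlib

open Polynomial Finset

/-- `A(b,a;n,m) ∈ ℤ[q]`: the polynomial `(1-q^a)·∏_{i=1}^m (1-q^i)·∏_{i=1}^{n-m} (1-q^i)`
divides `(1-q^b)·∏_{i=1}^n (1-q^i)` in `ℤ[q]`. -/
def AIsPoly (b a n m : ℕ) : Prop :=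
  ((1 - X ^ a) * (∏ i ∈ range m, (1 - X ^ (i + 1))) *
      ∏ i ∈ range (n - m), (1 - X ^ (i + 1)) : Polynomial ℤ) ∣
    (1 - X ^ b) * ∏ i ∈ range n, (1 - X ^ (i + 1))

theorem Polynomial.rootMultiplicity_one_sub_X_pow {ζ : ℂ} {d : ℕ} (hζ : IsPrimitiveRoot ζ d)
    {k : ℕ} (hk : k ≠ 0) :
    (1 - X ^ k : ℂ[X]).rootMultiplicity ζ = if d ∣ k then 1 else 0 := by
  have hsep : (1 - X ^ k : ℂ[X]).Separable := by
    have h := separable_X_pow_sub_C (1 : ℂ) (Nat.cast_ne_zero.mpr hk) one_ne_zero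
    refine h.of_dvd ?_
    rw [C_1, ← neg_sub, neg_dvd]
  have hle := rootMultiplicity_le_one_of_separable hsep ζ
  have hroot : (1 - X ^ k : ℂ[X]).IsRoot ζ ↔ d ∣ k := by
    rw [← hζ.pow_eq_one_iff_dvd]
    rw [IsRoot.def, eval_sub, eval_one, eval_pow, eval_X, sub_eq_zero, eq_comm]
  split_ifs with h
  · have := (rootMultiplicity_pos hsep.ne_zero).2 (hroot.2 h)
    omega
  · exact rootMultiplicity_eq_zero (mt hroot.1 h)

theorem Polynomial.one_sub_X_pow_ne_zero {k : ℕ} (hk : k ≠ 0) : (1 - X ^ k : ℂ[X]) ≠ 0 := by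
  intro h
  simpa [hk] using congrArg (eval 0) h

theorem Polynomial.prod_one_sub_X_pow_ne_zero (N : ℕ) :
    (∏ i ∈ range N, (1 - X ^ (i + 1)) : ℂ[X]) ≠ 0 :=
  prod_ne_zero_iff.2 fun i _ => one_sub_X_pow_ne_zero i.succ_ne_zero

theorem Polynomial.rootMultiplicity_prod_one_sub_X_pow {ζ : ℂ} {d : ℕ}
    (hζ : IsPrimitiveRoot ζ d) (N : ℕ) :
    (∏ i ∈ range N, (1 - X ^ (i + 1)) : ℂ[X]).rootMultiplicity ζ = N / d := by
  induction N with
  | zero => simp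
  | succ N ih =>
    have hne := prod_one_sub_X_pow_ne_zero (N + 1)
    rw [prod_range_succ] at hne ⊢
    rw [rootMultiplicity_mul hne, ih, rootMultiplicity_one_sub_X_pow hζ N.succ_ne_zero,
      Nat.succ_div]

theorem AIsPoly.div_add_div_lt {n N M : ℕ} (hn : n ≠ 0) (hA : AIsPoly 1 n N M) {d : ℕ}
    (hd : 1 < d) (hdn : d ∣ n) : M / d + (N - M) / d < N / d := by
  have hζ := Complex.isPrimitiveRoot_exp d (by omega)
  have hdvd := Polynomial.map_dvd (Int.castRingHom ℂ) hA
  simp only [Polynomial.map_mul, Polynomial.map_sub, Polynomial.map_one, Polynomial.map_pow,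
    Polynomial.map_X, Polynomial.map_prod] at hdvd
  have hne : ((1 - X ^ 1) * ∏ i ∈ range N, (1 - X ^ (i + 1)) : ℂ[X]) ≠ 0 :=
    mul_ne_zero (one_sub_X_pow_ne_zero one_ne_zero) (prod_one_sub_X_pow_ne_zero N)
  have hne₂ : ((1 - X ^ n) * ∏ i ∈ range M, (1 - X ^ (i + 1)) : ℂ[X]) ≠ 0 :=
    mul_ne_zero (one_sub_X_pow_ne_zero hn) (prod_one_sub_X_pow_ne_zero M)
  have hle := rootMultiplicity_le_rootMultiplicity_of_dvd hne hdvd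
    (Complex.exp (2 * Real.pi * Complex.I / d))
  rw [rootMultiplicity_mul hne,
    rootMultiplicity_mul (mul_ne_zero hne₂ (prod_one_sub_X_pow_ne_zero _)),
    rootMultiplicity_mul hne₂, rootMultiplicity_one_sub_X_pow hζ hn,
    rootMultiplicity_one_sub_X_pow hζ one_ne_zero, if_pos hdn,
    if_neg (by rw [Nat.dvd_one]; omega)] at hle
  simp only [rootMultiplicity_prod_one_sub_X_pow hζ] at hle
  omega

theorem Nat.dvd_choose_of_le_mod_add_mod {n a b : ℕ} (hn : n ≠ 0) (hba : b ≤ a)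
    (h : ∀ d, 1 < d → d ∣ n → d ≤ b % d + (a - b) % d) : n ∣ a.choose b := by
  rw [← Nat.factorization_le_iff_dvd hn (Nat.choose_pos hba).ne']
  intro p
  by_cases hp : p.Prime
  swap
  · simp [hp]
  rw [Nat.factorization_choose hp hba (b := max (n.factorization p) (Nat.log p a) + 1)
    (by omega)]
  calc n.factorization p = #(Ico 1 (n.factorization p + 1)) := by simp
    _ ≤ _ := card_le_card fun i hi => by
      simp only [mem_Ico, mem_filter] at hi ⊢
      exact ⟨by omega, h _ (Nat.one_lt_pow (by omega) hp.one_lt)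
        ((pow_dvd_pow p (by omega)).trans (Nat.ordProj_dvd n p))⟩

theorem stmt8 (n N M : ℕ) (hn : 0 < n) (hMN : M ≤ N) (hA : AIsPoly 1 n N M) (m : ℕ) :
    n ∣ ∑ j ∈ (Finset.range (N + m * n + 1)).filter (fun j => M + j * n ≤ N + m * n),
        Nat.choose (N + m * n) (M + j * n) := by
  refine Finset.dvd_sum fun j hj => ?_
  have hj := (Finset.mem_filter.1 hj).2
  refine Nat.dvd_choose_of_le_mod_add_mod hn.ne' hj fun d hd hdn => ?_
  have hM : (M + j * n) % d = M % d := by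
    obtain ⟨k, rfl⟩ := hdn
    simp [mul_left_comm j d k]
  have hsub : (N + m * n - (M + j * n)) % d = (N - M) % d := by
    have hn0 : n ≡ 0 [MOD d] := (Nat.modEq_zero_iff_dvd).2 hdn
    have hm0 : ∀ l, l * n ≡ 0 [MOD d] := fun l => by simpa using hn0.mul_left l
    refine Nat.ModEq.add_right_cancel' (M + j * n) ?_
    rw [Nat.sub_add_cancel hj, ← add_assoc, Nat.sub_add_cancel hMN]
    exact ((hm0 m).trans (hm0 j).symm).add_left N
  rw [hM, hsub]
  by_contra! hlt
  have hdiv := hA.div_add_div_lt hn.ne' hd hdn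
  have hadd := Nat.add_div (a := M) (b := N - M) (c := d) (by omega)
  rw [if_neg (by omega), Nat.add_sub_cancel' hMN] at hadd
  omega
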